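/- Poisson Summation Formula, degenerate lattice case: let Λ ⊂ ℝ^m be a full-rank lattice with basis matrix B and d ≥ 0. For any Schwartz function φ on ℝ^m × ℝ^d, ∑_{a ∈ Λ} φ(a, 0) = (1/|det B|) ∫_{ℝ^d} ∑_{b ∈ (B^{-1})^T ℤ^m} φ̂(b, y) dy. -/

import Mathlib

open Matrix MeasureTheory Real

/-- cast of an integer vector -/
noncomputable def psfCast {m : ℕ} (n : Fin m → ℤ) : Fin m → ℝ := fun i => (n i : ℝ)

theorem psf_summable (m : ℕ) :
    Summable fun n : Fin m → ℤ => ((1 + ‖psfCast n‖) ^ (m + 1))⁻¹ := by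
  let b := Pi.basisFun ℝ (Fin m)
  let L : Submodule ℤ (Fin m → ℝ) := Submodule.span ℤ (Set.range b)
  have hfin : Module.finrank ℤ L < m + 1 := by
    rw [ZLattice.rank ℝ L]; simp
  have h1 := ZLattice.summable_norm_pow_inv L (m + 1) hfin
  have hmem : ∀ n : Fin m → ℤ, psfCast n ∈ L := by
    intro n
    have : psfCast n = ∑ i, n i • b i := by
      ext j
      simp [psfCast, b, Finset.sum_apply, Pi.single_apply]
    rw [this]
    exact Submodule.sum_mem _ fun i _ => Submodule.smul_mem _ _ (Submodule.subset_span ⟨i, rfl⟩)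
  have hinj : Function.Injective (fun n : Fin m → ℤ => (⟨psfCast n, hmem n⟩ : L)) := by
    intro n n' h
    have h' : psfCast n = psfCast n' := congrArg Subtype.val h
    ext i
    have := congrFun h' i
    simpa [psfCast] using this
  have h2 := h1.comp_injective hinj
  refine Summable.of_norm_bounded_eventually h2 ?_
  refine (Set.finite_singleton (0 : Fin m → ℤ)).subset ?_
  intro n hn
  by_contra hne
  apply hn
  have hne' : psfCast n ≠ 0 := by
    intro h
    apply hne
    ext i
    have := congrFun h i
    simpa [psfCast] using this
  have hpos : 0 < ‖psfCast n‖ := norm_pos_iff.mpr hne'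
  show ‖((1 + ‖psfCast n‖) ^ (m + 1))⁻¹‖ ≤ ‖psfCast n‖⁻¹ ^ (m + 1)
  rw [Real.norm_of_nonneg (by positivity), inv_pow]
  gcongr
  linarith

theorem psf_decay {E : Type*} [NormedAddCommGroup E] [NormedSpace ℝ E] (f : SchwartzMap E ℂ)
    (k : ℕ) : ∃ C : ℝ, 0 ≤ C ∧ ∀ x, ‖f x‖ ≤ C * ((1 + ‖x‖) ^ k)⁻¹ := by
  refine ⟨2 ^ k * (Finset.Iic (k, 0)).sup (fun m => SchwartzMap.seminorm ℝ m.1 m.2) f,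
    by positivity, fun x => ?_⟩
  have h := SchwartzMap.one_add_le_sup_seminorm_apply (𝕜 := ℝ) (m := (k, 0)) (k := k) (n := 0)
    le_rfl le_rfl f x
  rw [norm_iteratedFDeriv_zero] at h
  rw [← div_eq_mul_inv, le_div_iff₀ (by positivity), mul_comm]
  exact h

theorem psf_integrable_bound (m : ℕ) :
    Integrable (fun x : Fin m → ℝ => ((1 + ‖x‖) ^ (m + 1))⁻¹) := by
  have h := integrable_one_add_norm (E := Fin m → ℝ) (μ := volume) (r := ((m + 1 : ℕ) : ℝ))
    (by simp)
  refine h.congr (Filter.Eventually.of_forall fun x => ?_)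
  show (1 + ‖x‖) ^ (-((m + 1 : ℕ) : ℝ)) = _
  rw [Real.rpow_neg (by positivity), Real.rpow_natCast]

theorem psf_integrable {m : ℕ} {g : (Fin m → ℝ) → ℂ} (hg : Continuous g) {C : ℝ}
    (hC : ∀ x, ‖g x‖ ≤ C * ((1 + ‖x‖) ^ (m + 1))⁻¹) : Integrable g :=
  ((psf_integrable_bound m).const_mul C).mono' hg.aestronglyMeasurable
    (Filter.Eventually.of_forall hC)

theorem psf_periodized_bound {m : ℕ} {g : (Fin m → ℝ) → ℂ} {C : ℝ} (hC0 : 0 ≤ C)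
    (hC : ∀ x, ‖g x‖ ≤ C * ((1 + ‖x‖) ^ (m + 1))⁻¹) {R : ℝ} (x : Fin m → ℝ) (hx : ‖x‖ ≤ R)
    (n : Fin m → ℤ) :
    ‖g (x + psfCast n)‖ ≤ C * (1 + R) ^ (m + 1) * ((1 + ‖psfCast n‖) ^ (m + 1))⁻¹ := by
  have hR : 0 ≤ R := (norm_nonneg x).trans hx
  refine (hC _).trans ?_
  rw [mul_assoc]
  refine mul_le_mul_of_nonneg_left ?_ hC0
  rw [← div_eq_mul_inv, le_div_iff₀ (by positivity), inv_mul_le_iff₀ (by positivity), ← mul_pow]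
  gcongr
  have h1 : ‖psfCast n‖ ≤ ‖x + psfCast n‖ + ‖x‖ := by
    have := norm_sub_le (x + psfCast n) x
    simpa using this
  nlinarith [norm_nonneg (x + psfCast n), norm_nonneg x]

theorem psf_continuous_periodized {m : ℕ} {g : (Fin m → ℝ) → ℂ} (hg : Continuous g) {C : ℝ}
    (hC0 : 0 ≤ C) (hC : ∀ x, ‖g x‖ ≤ C * ((1 + ‖x‖) ^ (m + 1))⁻¹) :
    Continuous fun x => ∑' n : Fin m → ℤ, g (x + psfCast n) := by
  rw [continuous_iff_continuousAt]
  intro x₀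
  have hO : ContinuousOn (fun x => ∑' n : Fin m → ℤ, g (x + psfCast n))
      (Metric.ball 0 (‖x₀‖ + 1)) := by
    refine continuousOn_tsum (fun n => (by fun_prop : Continuous _).continuousOn)
      ((psf_summable m).mul_left (C * (1 + (‖x₀‖ + 1)) ^ (m + 1))) ?_
    intro n x hx
    refine psf_periodized_bound hC0 hC x ?_ n
    simpa using (Metric.mem_ball.mp hx).le
  exact hO.continuousAt (Metric.isOpen_ball.mem_nhds (by simp))

/-- the unit cube with corner `n` -/
def psfCube {m : ℕ} (n : Fin m → ℤ) : Set (Fin m → ℝ) :=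
  {x | ∀ i, x i ∈ Set.Ioc (n i : ℝ) ((n i : ℝ) + 1)}

theorem psfCube_measurable {m : ℕ} (n : Fin m → ℤ) : MeasurableSet (psfCube n) :=
  MeasurableSet.univ_pi' (fun _ => measurableSet_Ioc)

theorem psfCube_disjoint {m : ℕ} :
    Pairwise (Function.onFun Disjoint (psfCube : (Fin m → ℤ) → Set (Fin m → ℝ))) := by
  intro n n' hnn
  rw [Function.onFun, Set.disjoint_left]
  intro x hx hx'
  apply hnn
  ext i
  have h1 := hx i
  have h2 := hx' i
  rw [Set.mem_Ioc] at h1 h2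
  have a1 : (n i : ℝ) < n' i + 1 := by linarith
  have a2 : (n' i : ℝ) < n i + 1 := by linarith
  have a1 : n i < n' i + 1 := by exact_mod_cast a1
  have a2 : n' i < n i + 1 := by exact_mod_cast a2
  omega

theorem psfCube_iUnion {m : ℕ} :
    (⋃ n : Fin m → ℤ, psfCube n) = (Set.univ : Set (Fin m → ℝ)) := by
  refine Set.eq_univ_of_forall fun x => Set.mem_iUnion.mpr ⟨fun i => ⌈x i⌉ - 1, fun i => ?_⟩
  have h1 := Int.ceil_lt_add_one (x i)
  have h2 := Int.le_ceil (x i)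
  constructor
  · push_cast; linarith
  · push_cast; linarith

theorem psfCube_integral {m : ℕ} {E : Type*} [NormedAddCommGroup E] [NormedSpace ℝ E]
    (f : (Fin m → ℝ) → E) (n : Fin m → ℤ) :
    ∫ x in psfCube n, f x = ∫ x in psfCube (0 : Fin m → ℤ), f (x + psfCast n) := by
  have h := (measurePreserving_add_right (volume : Measure (Fin m → ℝ))
    (psfCast n)).setIntegral_preimage_emb (measurableEmbedding_addRight _) f (psfCube n)
  rw [← h]
  congr 2
  ext x
  simp only [psfCube, psfCast, Set.mem_preimage, Set.mem_ofPred_eq, Pi.add_apply, Set.mem_Ioc]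
  refine forall_congr' fun i => ?_
  simp only [Pi.zero_apply, Int.cast_zero]
  constructor <;> rintro ⟨h1, h2⟩ <;> constructor <;> linarith

theorem psf_unfold {m : ℕ} {E : Type*} [NormedAddCommGroup E] [NormedSpace ℝ E]
    {f : (Fin m → ℝ) → E} (hf : Integrable f) :
    HasSum (fun n : Fin m → ℤ => ∫ x in psfCube (0 : Fin m → ℤ), f (x + psfCast n))
      (∫ x, f x) := by
  have h := hasSum_integral_iUnion (μ := volume) (f := f) (s := psfCube (m := m))
    psfCube_measurable psfCube_disjoint hf.integrableOn
  rw [psfCube_iUnion, setIntegral_univ] at h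
  simpa only [psfCube_integral f] using h

theorem psf_unfold_tsum {m : ℕ} {f : (Fin m → ℝ) → ℂ} (hf : Integrable f) :
    ∫ x in psfCube (0 : Fin m → ℤ), ∑' n : Fin m → ℤ, f (x + psfCast n) = ∫ x, f x := by
  have h1 := psf_unfold hf
  have h2 := (psf_unfold hf.norm).summable
  have h3 := hasSum_integral_of_summable_integral_norm
    (μ := volume.restrict (psfCube (0 : Fin m → ℤ)))
    (F := fun (n : Fin m → ℤ) x => f (x + psfCast n))
    (fun n => (hf.comp_add_right (psfCast n)).integrableOn) h2
  exact h3.unique h1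

theorem psf_mFourier {m : ℕ} (n : Fin m → ℤ) (x : Fin m → ℝ) :
    UnitAddTorus.mFourier (-n) (fun i => (x i : UnitAddCircle))
      = Complex.exp (-(2 * π * Complex.I * ((psfCast n ⬝ᵥ x : ℝ) : ℂ))) := by
  simp only [UnitAddTorus.mFourier, ContinuousMap.coe_mk, fourier_coe_apply, ← Complex.exp_sum]
  congr 1
  simp only [dotProduct, psfCast, Complex.ofReal_sum, Finset.mul_sum, ← Finset.sum_neg_distrib]
  refine Finset.sum_congr rfl fun i _ => ?_
  simp only [Pi.neg_apply]
  push_cast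
  ring

theorem psf_exp_periodic {m : ℕ} (n k : Fin m → ℤ) (x : Fin m → ℝ) :
    Complex.exp (-(2 * π * Complex.I * ((psfCast n ⬝ᵥ (x + psfCast k) : ℝ) : ℂ)))
      = Complex.exp (-(2 * π * Complex.I * ((psfCast n ⬝ᵥ x : ℝ) : ℂ))) := by
  rw [← psf_mFourier, ← psf_mFourier]
  congr 1
  ext i
  simp [psfCast]

theorem psf_norm_exp (t : ℝ) : ‖Complex.exp (-(2 * π * Complex.I * (t : ℂ)))‖ = 1 := by
  rw [show -(2 * π * Complex.I * (t : ℂ)) = ((-(2 * π * t) : ℝ) : ℂ) * Complex.I by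
    push_cast; ring]
  exact Complex.norm_exp_ofReal_mul_I _

theorem psf_poisson {m : ℕ} {g : (Fin m → ℝ) → ℂ} (hg : Continuous g) {C : ℝ}
    (hC0 : 0 ≤ C) (hC : ∀ x, ‖g x‖ ≤ C * ((1 + ‖x‖) ^ (m + 1))⁻¹)
    (hs : Summable fun n : Fin m → ℤ => ∫ α : Fin m → ℝ,
      g α * Complex.exp (-(2 * π * Complex.I * ((psfCast n ⬝ᵥ α : ℝ) : ℂ)))) :
    ∑' n : Fin m → ℤ, g (psfCast n) = ∑' n : Fin m → ℤ, ∫ α : Fin m → ℝ,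
      g α * Complex.exp (-(2 * π * Complex.I * ((psfCast n ⬝ᵥ α : ℝ) : ℂ))) := by
  let q : (Fin m → ℝ) → UnitAddTorus (Fin m) := Pi.map (fun _ => ((↑) : ℝ → UnitAddCircle))
  have hq : IsOpenQuotientMap q :=
    IsOpenQuotientMap.piMap fun _ => QuotientAddGroup.isOpenQuotientMap_mk
  let P : (Fin m → ℝ) → ℂ := fun x => ∑' n : Fin m → ℤ, g (x + psfCast n)
  have hP : Continuous P := psf_continuous_periodized hg hC0 hC
  have hPper : ∀ x y, q x = q y → P x = P y := by
    intro x y hxy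
    have hk : ∀ i, ∃ k : ℤ, y i = x i + k := by
      intro i
      have := congrFun hxy i
      simp only [q, Pi.map_apply] at this
      obtain ⟨k, hk⟩ := (QuotientAddGroup.eq_iff_sub_mem.mp this.symm)
      refine ⟨k, ?_⟩
      simp only [zsmul_eq_mul, mul_one] at hk
      linarith
    choose k hk using hk
    have hyx : y = x + psfCast k := by ext i; simp [hk, psfCast]
    show ∑' n : Fin m → ℤ, g (x + psfCast n) = ∑' n : Fin m → ℤ, g (y + psfCast n)
    rw [hyx, ← (Equiv.addLeft k).tsum_eq]
    refine tsum_congr fun n => ?_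
    congr 1
    ext i
    simp [psfCast, add_assoc]
  let F : UnitAddTorus (Fin m) → ℂ := fun t => P (Function.surjInv hq.surjective t)
  have hF : ∀ x, F (q x) = P x := fun x => hPper _ _ (Function.surjInv_eq hq.surjective _)
  have hFc : Continuous F := by
    rw [hq.isQuotientMap.continuous_iff]
    exact hP.congr fun x => (hF x).symm
  let FC : C(UnitAddTorus (Fin m), ℂ) := ⟨F, hFc⟩
  have hint : Integrable g := psf_integrable hg hC
  have hcoef : ∀ n, UnitAddTorus.mFourierCoeff FC n = ∫ α : Fin m → ℝ,
      g α * Complex.exp (-(2 * π * Complex.I * ((psfCast n ⬝ᵥ α : ℝ) : ℂ))) := by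
    intro n
    rw [UnitAddTorus.mFourierCoeff_eq_integral _ n 0]
    have hint2 : Integrable fun α : Fin m → ℝ =>
        g α * Complex.exp (-(2 * π * Complex.I * ((psfCast n ⬝ᵥ α : ℝ) : ℂ))) := by
      refine hint.mul_bdd (c := 1) ?_ (Filter.Eventually.of_forall fun x => (psf_norm_exp _).le)
      refine Continuous.aestronglyMeasurable ?_
      simp only [dotProduct]
      fun_prop
    rw [← psf_unfold_tsum hint2]
    have hset : {x : Fin m → ℝ | ∀ i, x i ∈ Set.Ioc ((0 : Fin m → ℝ) i) ((0 : Fin m → ℝ) i + 1)}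
        = psfCube 0 := by
      simp [psfCube]
    rw [hset]
    refine integral_congr_ae (Filter.Eventually.of_forall fun x => ?_)
    show _ • F (q x) = _
    simp only [psf_exp_periodic]
    rw [hF, tsum_mul_right, psf_mFourier, smul_eq_mul, mul_comm]
  have hs' : Summable (UnitAddTorus.mFourierCoeff FC) := by
    rw [funext hcoef]; exact hs
  have h := (UnitAddTorus.hasSum_mFourier_series_apply_of_summable hs' (q 0)).tsum_eq
  have h0 : FC (q 0) = ∑' n : Fin m → ℤ, g (psfCast n) := by
    show F (q 0) = _
    rw [hF]
    simp [P]
  rw [← h0, ← h]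
  refine tsum_congr fun n => ?_
  rw [hcoef]
  have := psf_mFourier (-n) 0
  rw [neg_neg] at this
  have h1 : UnitAddTorus.mFourier n (q 0) = 1 := by
    refine this.trans ?_
    simp
  rw [h1, smul_eq_mul, mul_one]

/-- Schwartz functions on a product decay in each variable separately. -/
theorem psf_decay_prod {m d : ℕ} (f : SchwartzMap ((Fin m → ℝ) × (Fin d → ℝ)) ℂ) :
    ∃ C : ℝ, 0 ≤ C ∧ ∀ a x,
      ‖f (a, x)‖ ≤ C * (((1 + ‖a‖) ^ (m + 1))⁻¹ * ((1 + ‖x‖) ^ (d + 1))⁻¹) := by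
  obtain ⟨C, hC0, hC⟩ := psf_decay f ((m + 1) + (d + 1))
  refine ⟨C, hC0, fun a x => (hC (a, x)).trans ?_⟩
  refine mul_le_mul_of_nonneg_left ?_ hC0
  rw [← mul_inv, pow_add]
  have h1 : ‖a‖ ≤ ‖(a, x)‖ := norm_fst_le (a, x)
  have h2 : ‖x‖ ≤ ‖(a, x)‖ := norm_snd_le (a, x)
  gcongr

theorem psf_hat {m d : ℕ} (ψ : SchwartzMap ((Fin m → ℝ) × (Fin d → ℝ)) ℂ) :
    ∃ F : SchwartzMap ((Fin m → ℝ) × (Fin d → ℝ)) ℂ, ∀ b y, F (b, y) =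
      ∫ x : Fin d → ℝ, ∫ α : Fin m → ℝ,
        ψ (α, x) * Complex.exp (-(2 * π * Complex.I * ((b ⬝ᵥ α + y ⬝ᵥ x : ℝ) : ℂ))) := by
  let e : EuclideanSpace ℝ (Fin m ⊕ Fin d) ≃L[ℝ] (Fin m → ℝ) × (Fin d → ℝ) :=
    (EuclideanSpace.equiv (Fin m ⊕ Fin d) ℝ).trans
      (ContinuousLinearEquiv.sumPiEquivProdPi ℝ (Fin m) (Fin d) (fun _ => ℝ))
  have he : MeasurePreserving e volume volume :=
    (volume_measurePreserving_sumPiEquivProdPi (fun _ : Fin m ⊕ Fin d => ℝ)).comp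
      (PiLp.volume_preserving_ofLp (Fin m ⊕ Fin d))
  have hinner : ∀ v w, inner ℝ v w = (e w).1 ⬝ᵥ (e v).1 + (e w).2 ⬝ᵥ (e v).2 := by
    intro v w
    rw [PiLp.inner_apply, Fintype.sum_sum_type]
    rfl
  let ψ' : SchwartzMap (EuclideanSpace ℝ (Fin m ⊕ Fin d)) ℂ :=
    SchwartzMap.compCLMOfContinuousLinearEquiv ℂ e ψ
  let F' : SchwartzMap (EuclideanSpace ℝ (Fin m ⊕ Fin d)) ℂ := FourierTransform.fourier ψ'
  refine ⟨SchwartzMap.compCLMOfContinuousLinearEquiv ℂ e.symm F', fun b y => ?_⟩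
  show (FourierTransform.fourier ψ') (e.symm (b, y)) = _
  rw [SchwartzMap.fourier_coe, Real.fourier_eq']
  have hint : Integrable (fun p : (Fin m → ℝ) × (Fin d → ℝ) => ψ p *
      Complex.exp (-(2 * π * Complex.I * ((b ⬝ᵥ p.1 + y ⬝ᵥ p.2 : ℝ) : ℂ)))) := by
    have hψi : Integrable (ψ : (Fin m → ℝ) × (Fin d → ℝ) → ℂ) :=
      (he.integrable_comp_emb e.toHomeomorph.measurableEmbedding).mp ψ'.integrable
    refine hψi.mul_bdd (c := 1) ?_
      (Filter.Eventually.of_forall fun x => (psf_norm_exp _).le)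
    refine Continuous.aestronglyMeasurable ?_
    simp only [dotProduct]
    fun_prop
  have h2 := integral_prod_symm _ hint
  rw [← h2, ← Measure.volume_eq_prod, ← he.integral_comp e.toHomeomorph.measurableEmbedding]
  refine integral_congr_ae (Filter.Eventually.of_forall fun v => ?_)
  show _ • ψ (e v) = ψ (e v) * _
  rw [hinner, smul_eq_mul, mul_comm]
  simp only [ContinuousLinearEquiv.apply_symm_apply]
  congr 2
  push_cast
  ring

theorem psf_inversion {d : ℕ} {h : (Fin d → ℝ) → ℂ} (hc : Continuous h) (hi : Integrable h)
    (hH : Integrable fun y : Fin d → ℝ => ∫ x : Fin d → ℝ,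
      h x * Complex.exp (-(2 * π * Complex.I * ((y ⬝ᵥ x : ℝ) : ℂ)))) :
    ∫ y : Fin d → ℝ, ∫ x : Fin d → ℝ,
      h x * Complex.exp (-(2 * π * Complex.I * ((y ⬝ᵥ x : ℝ) : ℂ))) = h 0 := by
  let e : EuclideanSpace ℝ (Fin d) ≃L[ℝ] (Fin d → ℝ) := EuclideanSpace.equiv (Fin d) ℝ
  have he : MeasurePreserving e volume volume := PiLp.volume_preserving_ofLp (Fin d)
  have hem := e.toHomeomorph.measurableEmbedding
  have hF : FourierTransform.fourier (h ∘ e) = (fun y : Fin d → ℝ => ∫ x : Fin d → ℝ,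
      h x * Complex.exp (-(2 * π * Complex.I * ((y ⬝ᵥ x : ℝ) : ℂ)))) ∘ e := by
    ext w
    rw [Real.fourier_eq']
    simp only [Function.comp]
    rw [← he.integral_comp hem]
    refine integral_congr_ae (Filter.Eventually.of_forall fun v => ?_)
    have hinner : inner ℝ v w = e w ⬝ᵥ e v := by
      rw [PiLp.inner_apply]; rfl
    simp only [hinner, smul_eq_mul]
    rw [mul_comm]
    congr 2
    push_cast
    ring
  have hi' : Integrable (h ∘ e) := (he.integrable_comp_emb hem).mpr hi
  have hF' : Integrable (FourierTransform.fourier (h ∘ e)) := by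
    rw [hF]; exact (he.integrable_comp_emb hem).mpr hH
  have key := hi'.fourierInv_fourier_eq hF' (v := 0) (hc.comp e.continuous).continuousAt
  rw [Real.fourierInv_eq', hF] at key
  simp only [inner_zero_right, mul_zero, Complex.ofReal_zero, zero_mul, Complex.exp_zero,
    one_smul, Function.comp, map_zero] at key
  rw [← key]
  exact (he.integral_comp hem _).symm

theorem psf_core {m d : ℕ} (ψ : SchwartzMap ((Fin m → ℝ) × (Fin d → ℝ)) ℂ) :
    ∑' a : Fin m → ℤ, ψ (psfCast a, 0)
      = ∫ y : Fin d → ℝ, ∑' b : Fin m → ℤ, ∫ x : Fin d → ℝ, ∫ α : Fin m → ℝ,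
        ψ (α, x) *
          Complex.exp (-(2 * π * Complex.I * ((psfCast b ⬝ᵥ α + y ⬝ᵥ x : ℝ) : ℂ))) := by
  obtain ⟨F, hF⟩ := psf_hat ψ
  simp only [← hF]
  obtain ⟨C, hC0, hC⟩ := psf_decay_prod ψ
  obtain ⟨D, hD0, hD⟩ := psf_decay_prod F
  -- integrability of slices of `F`
  have hFi : ∀ b, Integrable fun y => F (b, y) := by
    intro b
    refine psf_integrable (C := D * ((1 + ‖b‖) ^ (m + 1))⁻¹) (by fun_prop) fun y => ?_
    rw [mul_assoc]
    exact hD b y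
  have hFsum : Summable fun b : Fin m → ℤ => ∫ y, ‖F (psfCast b, y)‖ := by
    refine Summable.of_nonneg_of_le (fun b => integral_nonneg fun y => norm_nonneg _) (fun b => ?_)
      ((psf_summable m).mul_left (D * ∫ y : Fin d → ℝ, ((1 + ‖y‖) ^ (d + 1))⁻¹))
    calc ∫ y, ‖F (psfCast b, y)‖
        ≤ ∫ y : Fin d → ℝ, D * ((1 + ‖psfCast b‖) ^ (m + 1))⁻¹ * ((1 + ‖y‖) ^ (d + 1))⁻¹ := by
          refine integral_mono (hFi _).norm ((psf_integrable_bound d).const_mul _) fun y => ?_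
          simp only [mul_assoc]
          exact hD _ y
      _ = _ := by rw [integral_const_mul]; ring
  have hsum := hasSum_integral_of_summable_integral_norm (fun b => hFi (psfCast b)) hFsum
  -- inversion in the second variable
  have hinv : ∀ b, ∫ y, F (b, y) = ∫ α : Fin m → ℝ,
      ψ (α, 0) * Complex.exp (-(2 * π * Complex.I * ((b ⬝ᵥ α : ℝ) : ℂ))) := by
    intro b
    let h : (Fin d → ℝ) → ℂ := fun x => ∫ α : Fin m → ℝ,
      ψ (α, x) * Complex.exp (-(2 * π * Complex.I * ((b ⬝ᵥ α : ℝ) : ℂ)))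
    have hexp : Continuous fun α : Fin m → ℝ =>
        Complex.exp (-(2 * π * Complex.I * ((b ⬝ᵥ α : ℝ) : ℂ))) := by
      simp only [dotProduct]
      fun_prop
    have hbd : ∀ x α, ‖ψ (α, x) * Complex.exp (-(2 * π * Complex.I * ((b ⬝ᵥ α : ℝ) : ℂ)))‖
        ≤ C * (((1 + ‖α‖) ^ (m + 1))⁻¹ * ((1 + ‖x‖) ^ (d + 1))⁻¹) := by
      intro x α
      rw [norm_mul, psf_norm_exp, mul_one]
      exact hC α x
    have hc : Continuous h := by
      refine continuous_of_dominated (bound := fun α => C * ((1 + ‖α‖) ^ (m + 1))⁻¹)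
        (fun x => ?_) (fun x => Filter.Eventually.of_forall fun α => ?_)
        ((psf_integrable_bound m).const_mul C) (Filter.Eventually.of_forall fun α => ?_)
      · exact Continuous.aestronglyMeasurable (Continuous.mul (by fun_prop) hexp)
      · refine (hbd x α).trans ?_
        refine mul_le_mul_of_nonneg_left ?_ hC0
        refine mul_le_of_le_one_right (by positivity) ?_
        exact inv_le_one_of_one_le₀ (one_le_pow₀ (by linarith [norm_nonneg x]))
      · exact Continuous.mul (by fun_prop) continuous_const
    have hi : Integrable h := by
      refine psf_integrable (C := C * ∫ α : Fin m → ℝ, ((1 + ‖α‖) ^ (m + 1))⁻¹) hc fun x => ?_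
      refine (norm_integral_le_of_norm_le (((psf_integrable_bound m).mul_const
        (((1 + ‖x‖) ^ (d + 1))⁻¹)).const_mul C)
        (Filter.Eventually.of_forall (hbd x))).trans (le_of_eq ?_)
      rw [integral_const_mul, integral_mul_const, mul_assoc]
    have hFh : ∀ y, F (b, y) = ∫ x : Fin d → ℝ,
        h x * Complex.exp (-(2 * π * Complex.I * ((y ⬝ᵥ x : ℝ) : ℂ))) := by
      intro y
      rw [hF]
      refine integral_congr_ae (Filter.Eventually.of_forall fun x => ?_)
      simp only [h]
      rw [← integral_mul_const]
      refine integral_congr_ae (Filter.Eventually.of_forall fun α => ?_)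
      simp only []
      rw [mul_assoc (ψ _), ← Complex.exp_add]
      congr 2
      push_cast
      ring
    have hFi' := hFi b
    simp only [hFh] at hFi' ⊢
    exact psf_inversion hc hi hFi'
  rw [← hsum.tsum_eq]
  simp only [hinv]
  have hs := hsum.summable
  simp only [hinv] at hs
  refine psf_poisson (g := fun α => ψ (α, 0)) (by fun_prop) hC0 (fun α => ?_) hs
  simpa using hC α 0

theorem psf_change {m : ℕ} (B : Matrix (Fin m) (Fin m) ℝ) (hB : B.det ≠ 0)
    {f : (Fin m → ℝ) → ℂ} (hf : Continuous f) :
    ∫ α, f α = |B.det| • ∫ α, f (B.mulVec α) := by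
  have h := Real.map_matrix_volume_pi_eq_smul_volume_pi hB
  have hc : Continuous (toLin' B) := LinearMap.continuous_of_finiteDimensional _
  have h2 := integral_map (μ := volume) hc.measurable.aemeasurable
    (hf.aestronglyMeasurable (μ := Measure.map (toLin' B) volume))
  rw [h, integral_smul_measure, ENNReal.toReal_ofReal (abs_nonneg _)] at h2
  simp only [toLin'_apply] at h2
  rw [← h2, smul_smul, abs_inv, mul_inv_cancel₀ (abs_ne_zero.mpr hB), one_smul]

/-- Poisson Summation Formula, degenerate lattice case: for a full-rank lattice
`Λ = Bℤ^m ⊆ ℝ^m`, `d ≥ 0`, and any Schwartz `φ` on `ℝ^m × ℝ^d`,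
`∑_{a ∈ Λ} φ(a, 0) = (1/|det B|) ∫_{ℝ^d} ∑_{b ∈ (B⁻¹)ᵀℤ^m} φ̂(b, y) dy`. -/
theorem PSF_degenerate_lattice {m d : ℕ}
    (B : Matrix (Fin m) (Fin m) ℝ) (hB : B.det ≠ 0)
    (φ : SchwartzMap ((Fin m → ℝ) × (Fin d → ℝ)) ℂ)
    (φhat : (Fin m → ℝ) → (Fin d → ℝ) → ℂ)
    (hφhat : ∀ b y, φhat b y =
      ∫ x : Fin d → ℝ, ∫ α : Fin m → ℝ,
        φ (α, x) * Complex.exp (-(2 * π * Complex.I * ((b ⬝ᵥ α + y ⬝ᵥ x : ℝ) : ℂ)))) :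
    ∑' a : Fin m → ℤ, φ (B.mulVec (fun i => (a i : ℝ)), 0)
      = (1 / |B.det|) •
        ∫ y : Fin d → ℝ, ∑' b : Fin m → ℤ,
          φhat ((B⁻¹)ᵀ.mulVec (fun i => (b i : ℝ))) y := by
  have hu : IsUnit B.det := isUnit_iff_ne_zero.mpr hB
  let eB : (Fin m → ℝ) ≃L[ℝ] (Fin m → ℝ) :=
    (toLin'OfInv (nonsing_inv_mul B hu) (mul_nonsing_inv B hu)).toContinuousLinearEquiv
  have heB : ∀ α, eB α = B.mulVec α := fun α => by
    simp [eB, toLin'OfInv]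
  let ψ : SchwartzMap ((Fin m → ℝ) × (Fin d → ℝ)) ℂ :=
    SchwartzMap.compCLMOfContinuousLinearEquiv ℂ
      (eB.prodCongr (ContinuousLinearEquiv.refl ℝ (Fin d → ℝ))) φ
  have hψ : ∀ α x, ψ (α, x) = φ (B.mulVec α, x) := by
    intro α x
    rw [← heB]
    rfl
  have hdot : ∀ (b : Fin m → ℝ) (α : Fin m → ℝ), (B⁻¹)ᵀ.mulVec b ⬝ᵥ B.mulVec α = b ⬝ᵥ α := by
    intro b α
    rw [mulVec_transpose, ← dotProduct_mulVec, mulVec_mulVec, nonsing_inv_mul B hu, one_mulVec]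
  have hhat : ∀ (b : Fin m → ℤ) y, φhat ((B⁻¹)ᵀ.mulVec (fun i => (b i : ℝ))) y =
      |B.det| • ∫ x : Fin d → ℝ, ∫ α : Fin m → ℝ, ψ (α, x) *
          Complex.exp (-(2 * π * Complex.I * ((psfCast b ⬝ᵥ α + y ⬝ᵥ x : ℝ) : ℂ))) := by
    intro b y
    rw [hφhat, ← integral_smul]
    refine integral_congr_ae (Filter.Eventually.of_forall fun x => ?_)
    simp only []
    rw [psf_change B hB]
    · congr 1
      refine integral_congr_ae (Filter.Eventually.of_forall fun α => ?_)
      simp only [hψ, hdot]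
      rfl
    · simp only [dotProduct]
      fun_prop
  simp only [hhat]
  have hcore := psf_core ψ
  simp only [hψ] at hcore
  refine hcore.trans ?_
  simp only [tsum_const_smul'', integral_smul, smul_smul]
  rw [one_div_mul_cancel (abs_ne_zero.mpr hB), one_smul]
  simp only [hψ]
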